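/- (Refined multi-time equilibration bound.) Let ϱ be a Hermitian d×d complex matrix with equilibrium ϖ = 𝒟(ϱ), let 𝒜₀, …, 𝒜_k be linear maps on M_d each of which maps Hermitian matrices to Hermitian matrices, and let G^{(0)}, …, G^{(k)} : ι×ι → ℂ satisfy G^{(j)}_{nn} = 1 and G^{(j)}_{mn} = conj(G^{(j)}_{nm}) for all n, m, j, with associated partial dephasings 𝒢_j = 𝒢_{G^{(j)}}. Define ϱ_ℓ = 𝒢_ℓ ∘ 𝒜_{ℓ−1} ∘ ⋯ ∘ 𝒜₀ ∘ 𝒢₀ (ϱ) for 0 ≤ ℓ ≤ k, ϖ_ℓ = 𝒟 ∘ 𝒜_{ℓ−1} ∘ ⋯ ∘ 𝒜₀ ∘ 𝒟 (ϱ), write 𝒜_{b:a} = 𝒜_b ∘ ⋯ ∘ 𝒜_a, and set 𝔖_{b:a} = ∏_{j=a}^{b} max_{n≠m} |G^{(j)}_{nm}|. Then |tr[((𝒜_k∘𝒢_k) ∘ ⋯ ∘ (𝒜₀∘𝒢₀))(ϱ)] − tr[((𝒜_k∘𝒟) ∘ ⋯ ∘ (𝒜₀∘𝒟))(ϱ)]|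 ≤ 𝔖_{k:0} · ν(𝒜_{k:0}) · ‖ϱ − ϖ‖₂ + Σ_{ℓ=0}^{k−1} 𝔖_{k:ℓ+1} · ν(𝒜_{k:ℓ+1}) · ( ‖𝒜_ℓ‖ · ‖ϱ_ℓ − 𝒟(ϱ_ℓ)‖₂ + ‖𝒜_ℓ(ϱ_ℓ) − 𝒟(𝒜_ℓ(ϱ_ℓ))‖₂ ) + Σ_{ℓ=0}^{k−1} ν(𝒜_{k:ℓ+1}) · ( ‖𝒟(𝒜_ℓ(ϱ_ℓ)) − ϖ_{ℓ+1}‖₂ + ‖𝒜_ℓ‖ · ‖𝒟(ϱ_ℓ) − ϖ_ℓ‖₂ ). -/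

import Mathlib

open Matrix BigOperators

/-- The Frobenius (Hilbert–Schmidt) norm `‖X‖₂ = √(tr(XᴴX))`. -/
noncomputable def frob {d : ℕ} (X : Matrix (Fin d) (Fin d) ℂ) : ℝ :=
  Real.sqrt ((Xᴴ * X).trace.re)

/-- The dephasing map `𝒟(X) = Σ_n P_n X P_n`. -/
noncomputable def deph {d : ℕ} {ι : Type*} [Fintype ι]
    (P : ι → Matrix (Fin d) (Fin d) ℂ) (X : Matrix (Fin d) (Fin d) ℂ) :
    Matrix (Fin d) (Fin d) ℂ :=
  ∑ n, P n * X * P n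

/-- The partial dephasing map `𝒢_G(X) = Σ_{n,m} G_{nm} P_n X P_m`. -/
noncomputable def pdeph {d : ℕ} {ι : Type*} [Fintype ι]
    (P : ι → Matrix (Fin d) (Fin d) ℂ) (G : ι → ι → ℂ)
    (X : Matrix (Fin d) (Fin d) ℂ) : Matrix (Fin d) (Fin d) ℂ :=
  ∑ n, ∑ m, G n m • (P n * X * P m)

/-- `max_{n≠m} |G_{nm}|`, the maximum modulus of the off-diagonal coefficients. -/
noncomputable def maxOffDiag {ι : Type*} [Fintype ι] [DecidableEq ι] [Nontrivial ι]
    (G : ι → ι → ℂ) : ℝ :=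
  Finset.univ.offDiag.sup'
    (by
      obtain ⟨a, b, hab⟩ := exists_pair_ne ι
      exact ⟨(a, b), Finset.mem_offDiag.mpr ⟨Finset.mem_univ _, Finset.mem_univ _, hab⟩⟩)
    (fun p => ‖G p.1 p.2‖)

/-- `chainApply f n = f (n−1) ∘ ⋯ ∘ f 1 ∘ f 0` (the identity when `n = 0`). -/
def chainApply {M : Type*} (f : ℕ → M → M) : ℕ → M → M
  | 0, x => x
  | n + 1, x => f n (chainApply f n x)

/-- `chainFun f a n = f (a+n−1) ∘ ⋯ ∘ f (a+1) ∘ f a` (the identity when `n = 0`). -/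
def chainFun {M : Type*} (f : ℕ → M → M) (a : ℕ) : ℕ → M → M
  | 0, x => x
  | n + 1, x => f (a + n) (chainFun f a n x)

/-- `chainEnd f a n = f (a+n−1) ∘ ⋯ ∘ f (a+1) ∘ f a` in the endomorphism ring
(the identity map when `n = 0`). -/
noncomputable def chainEnd {d : ℕ}
    (f : ℕ → Module.End ℂ (Matrix (Fin d) (Fin d) ℂ)) (a n : ℕ) :
    Module.End ℂ (Matrix (Fin d) (Fin d) ℂ) :=
  (((List.range' a n).reverse).map f).prod

/-- The trace-functional norm `ν(𝒳) = sup_{‖σ‖₂=1} |tr(𝒳(σ))|` induced by the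
Frobenius norm. -/
noncomputable def nuFrob {d : ℕ} (𝒳 : Module.End ℂ (Matrix (Fin d) (Fin d) ℂ)) : ℝ :=
  ⨆ σ : {σ : Matrix (Fin d) (Fin d) ℂ // frob σ = 1}, ‖(𝒳 σ.1).trace‖


/-- The operator norm `‖𝒳‖ = sup_{‖σ‖₂=1} ‖𝒳(σ)‖₂` induced by the Frobenius norm. -/
noncomputable def opFrob {d : ℕ} (𝒳 : Module.End ℂ (Matrix (Fin d) (Fin d) ℂ)) : ℝ :=
  ⨆ σ : {σ : Matrix (Fin d) (Fin d) ℂ // frob σ = 1}, frob (𝒳 σ.1)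

theorem LinearMap.exists_norm_le_mul_norm {E : Type*} [NormedAddCommGroup E] [NormedSpace ℂ E]
    [FiniteDimensional ℂ E] (f : E →ₗ[ℂ] ℂ) : ∃ C : ℝ, ∀ x, ‖f x‖ ≤ C * ‖x‖ :=
  ⟨‖LinearMap.toContinuousLinearMap f‖, (LinearMap.toContinuousLinearMap f).le_opNorm⟩

section FrobeniusNorm

attribute [local instance] Matrix.frobeniusNormedAddCommGroup Matrix.frobeniusNormedSpace

theorem frob_eq_norm {d : ℕ} (X : Matrix (Fin d) (Fin d) ℂ) : frob X = ‖X‖ := by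
  rw [Matrix.frobenius_norm_def, frob, Real.sqrt_eq_rpow]
  congr 1
  simp only [Matrix.trace, Matrix.diag, Matrix.mul_apply, Matrix.conjTranspose_apply,
    Complex.re_sum, Real.rpow_two]
  rw [Finset.sum_comm]
  refine Finset.sum_congr rfl fun i _ => Finset.sum_congr rfl fun j _ => ?_
  rw [← Complex.normSq_eq_norm_sq, Complex.star_def, ← Complex.normSq_eq_conj_mul_self,
    Complex.ofReal_re]

theorem frob_nonneg {d : ℕ} (X : Matrix (Fin d) (Fin d) ℂ) : 0 ≤ frob X :=
  Real.sqrt_nonneg _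

theorem frob_smul {d : ℕ} (c : ℂ) (X : Matrix (Fin d) (Fin d) ℂ) :
    frob (c • X) = ‖c‖ * frob X := by
  simp only [frob_eq_norm, norm_smul]

open scoped ComplexOrder in
theorem frob_sq {d : ℕ} (X : Matrix (Fin d) (Fin d) ℂ) :
    frob X ^ 2 = ((Xᴴ * X).trace).re := by
  refine Real.sq_sqrt ?_
  have h := (Matrix.posSemidef_conjTranspose_mul_self X).trace_nonneg
  exact (Complex.le_def.mp h).1

theorem norm_trace_apply_le_nuFrob_mul {d : ℕ}
    (T : Module.End ℂ (Matrix (Fin d) (Fin d) ℂ)) (X : Matrix (Fin d) (Fin d) ℂ) :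
    ‖(T X).trace‖ ≤ nuFrob T * frob X := by
  obtain ⟨C, hC⟩ :=
    LinearMap.exists_norm_le_mul_norm (Matrix.traceLinearMap (Fin d) ℂ ℂ ∘ₗ T)
  have hbdd : BddAbove (Set.range
      fun σ : {σ : Matrix (Fin d) (Fin d) ℂ // frob σ = 1} => ‖(T σ.1).trace‖) := by
    refine ⟨C, ?_⟩
    rintro _ ⟨σ, rfl⟩
    have h := hC σ.1
    rwa [← frob_eq_norm, σ.2, mul_one] at h
  by_cases hX : X = 0
  · simp [hX, frob]
  · have hpos : 0 < frob X := by rw [frob_eq_norm]; exact norm_pos_iff.mpr hX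
    have hunit : frob (((frob X)⁻¹ : ℂ) • X) = 1 := by
      rw [frob_smul, norm_inv, Complex.norm_real, Real.norm_of_nonneg hpos.le,
        inv_mul_cancel₀ hpos.ne']
    have h := le_ciSup hbdd ⟨_, hunit⟩
    simp only [map_smul, Matrix.trace_smul, norm_smul, norm_inv, Complex.norm_real,
      Real.norm_of_nonneg hpos.le] at h
    rw [mul_comm]
    exact (inv_mul_le_iff₀ hpos).mp h

end FrobeniusNorm

theorem nuFrob_nonneg {d : ℕ} (T : Module.End ℂ (Matrix (Fin d) (Fin d) ℂ)) :
    0 ≤ nuFrob T :=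
  Real.iSup_nonneg fun _ => norm_nonneg _

theorem opFrob_nonneg {d : ℕ} (T : Module.End ℂ (Matrix (Fin d) (Fin d) ℂ)) :
    0 ≤ opFrob T :=
  Real.iSup_nonneg fun _ => frob_nonneg _

theorem norm_le_maxOffDiag {ι : Type*} [Fintype ι] [DecidableEq ι] [Nontrivial ι]
    (G : ι → ι → ℂ) {n m : ι} (h : n ≠ m) : ‖G n m‖ ≤ maxOffDiag G :=
  Finset.le_sup' (fun p : ι × ι => ‖G p.1 p.2‖) (b := (n, m)) (by simpa using h)

theorem maxOffDiag_nonneg {ι : Type*} [Fintype ι] [DecidableEq ι] [Nontrivial ι]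
    (G : ι → ι → ℂ) : 0 ≤ maxOffDiag G := by
  obtain ⟨a, b, hab⟩ := exists_pair_ne ι
  exact (norm_nonneg _).trans (norm_le_maxOffDiag G hab)

section Blocks

variable {d : ℕ} {ι : Type*} [Fintype ι] {P : ι → Matrix (Fin d) (Fin d) ℂ}

/-- Pythagoras for the block decomposition induced by a resolution of the identity. -/
theorem frob_sq_eq_sum_blocks (hHerm : ∀ n, (P n)ᴴ = P n) (hIdem : ∀ n, P n * P n = P n)
    (hSum : ∑ n, P n = 1) (X : Matrix (Fin d) (Fin d) ℂ) :
    frob X ^ 2 = ∑ n, ∑ m, frob (P n * X * P m) ^ 2 := by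
  have hblock : ∀ n m, ((P n * X * P m)ᴴ * (P n * X * P m)).trace
      = (Xᴴ * P n * X * P m).trace := fun n m => by
    calc ((P n * X * P m)ᴴ * (P n * X * P m)).trace
        = (P m * (Xᴴ * (P n * P n) * X * P m)).trace := by
          simp only [Matrix.conjTranspose_mul, hHerm, Matrix.mul_assoc]
      _ = (Xᴴ * P n * X * (P m * P m)).trace := by
          rw [Matrix.trace_mul_comm, hIdem, Matrix.mul_assoc _ (P m) (P m)]
      _ = (Xᴴ * P n * X * P m).trace := by rw [hIdem]
  simp only [frob_sq, hblock, ← Complex.re_sum, ← Matrix.trace_sum, ← Matrix.mul_sum,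
    ← Matrix.sum_mul, hSum, Matrix.mul_one]

variable [DecidableEq ι]

theorem mul_pdeph_mul (hOrth : ∀ n m, n ≠ m → P n * P m = 0)
    (hIdem : ∀ n, P n * P n = P n) (G : ι → ι → ℂ) (X : Matrix (Fin d) (Fin d) ℂ) (n m : ι) :
    P n * pdeph P G X * P m = G n m • (P n * X * P m) := by
  have hterm : ∀ a b, P n * (P a * X * P b) * P m
      = if a = n then (if b = m then P n * X * P m else 0) else 0 := fun a b => by
    have hassoc : P n * (P a * X * P b) * P m = (P n * P a) * X * (P b * P m) := by
      simp only [Matrix.mul_assoc]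
    rw [hassoc]
    split_ifs with ha hb
    · rw [ha, hb, hIdem, hIdem]
    · rw [hOrth b m hb, Matrix.mul_zero]
    · rw [hOrth n a (Ne.symm ha), Matrix.zero_mul, Matrix.zero_mul]
  simp [pdeph, Matrix.mul_sum, Matrix.sum_mul, hterm]

theorem deph_eq_pdeph (X : Matrix (Fin d) (Fin d) ℂ) :
    deph P X = pdeph P (fun n m => if n = m then 1 else 0) X := by
  simp [deph, pdeph]

theorem frob_pdeph_sub_deph_le [Nontrivial ι] (hHerm : ∀ n, (P n)ᴴ = P n)
    (hOrth : ∀ n m, n ≠ m → P n * P m = 0) (hIdem : ∀ n, P n * P n = P n)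
    (hSum : ∑ n, P n = 1) (G : ι → ι → ℂ) (hG : ∀ n, G n n = 1)
    (X : Matrix (Fin d) (Fin d) ℂ) :
    frob (pdeph P G X - deph P X) ≤ maxOffDiag G * frob (X - deph P X) := by
  have hS := maxOffDiag_nonneg G
  refine (sq_le_sq₀ (frob_nonneg _) (mul_nonneg hS (frob_nonneg _))).mp ?_
  rw [mul_pow, frob_sq_eq_sum_blocks hHerm hIdem hSum,
    frob_sq_eq_sum_blocks hHerm hIdem hSum (X - deph P X)]
  simp only [Finset.mul_sum]
  refine Finset.sum_le_sum fun n _ => Finset.sum_le_sum fun m _ => ?_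
  rw [deph_eq_pdeph]
  simp only [Matrix.mul_sub, Matrix.sub_mul, mul_pdeph_mul hOrth hIdem]
  by_cases hnm : n = m
  · subst hnm
    simp [hG, frob]
  · rw [if_neg hnm, zero_smul, sub_zero, sub_zero, frob_smul, mul_pow]
    have := norm_le_maxOffDiag G hnm
    gcongr

theorem norm_trace_pdeph_sub_le [Nontrivial ι] (hHerm : ∀ n, (P n)ᴴ = P n)
    (hOrth : ∀ n m, n ≠ m → P n * P m = 0) (hIdem : ∀ n, P n * P n = P n)
    (hSum : ∑ n, P n = 1) (G : ι → ι → ℂ) (hG : ∀ n, G n n = 1)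
    (T : Module.End ℂ (Matrix (Fin d) (Fin d) ℂ)) (X Y : Matrix (Fin d) (Fin d) ℂ) :
    ‖(T (pdeph P G X)).trace - (T Y).trace‖ ≤
      maxOffDiag G * nuFrob T * frob (X - deph P X) + nuFrob T * frob (deph P X - Y) := by
  have hsplit : (T (pdeph P G X)).trace - (T Y).trace
      = (T (pdeph P G X - deph P X)).trace + (T (deph P X - Y)).trace := by
    simp only [map_sub, Matrix.trace_sub]
    ring
  rw [hsplit]
  refine (norm_add_le _ _).trans (add_le_add ?_ (norm_trace_apply_le_nuFrob_mul T _))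
  calc ‖(T (pdeph P G X - deph P X)).trace‖
      ≤ nuFrob T * frob (pdeph P G X - deph P X) := norm_trace_apply_le_nuFrob_mul T _
    _ ≤ nuFrob T * (maxOffDiag G * frob (X - deph P X)) :=
        mul_le_mul_of_nonneg_left
          (frob_pdeph_sub_deph_le hHerm hOrth hIdem hSum G hG X) (nuFrob_nonneg T)
    _ = maxOffDiag G * nuFrob T * frob (X - deph P X) := by ring

end Blocks

theorem chainEnd_one {d : ℕ} (f : ℕ → Module.End ℂ (Matrix (Fin d) (Fin d) ℂ)) (a : ℕ) :
    chainEnd f a 1 = f a := by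
  simp [chainEnd]

/-- refined multi-time equilibration bound: for Hermitian `ϱ` with
equilibrium `ϖ = 𝒟(ϱ)`, Hermiticity-preserving linear maps `𝒜₀,…,𝒜_k`, partial
dephasings `𝒢_j = 𝒢_{G⁽ʲ⁾}` with unit-diagonal Hermitian coefficient families `G⁽ʲ⁾`,
and intermediate states `ϱ_ℓ = 𝒢_ℓ 𝒜_{ℓ−1} ⋯ 𝒜₀ 𝒢₀ (ϱ)`, `ϖ_ℓ = 𝒟 𝒜_{ℓ−1} ⋯ 𝒜₀ 𝒟 (ϱ)`:
`|tr[((𝒜_k𝒢_k)⋯(𝒜₀𝒢₀))(ϱ)] − tr[((𝒜_k𝒟)⋯(𝒜₀𝒟))(ϱ)]| ≤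
𝔖_{k:0} ν(𝒜_{k:0}) ‖ϱ − ϖ‖₂
+ Σ_{ℓ=0}^{k−1} 𝔖_{k:ℓ+1} ν(𝒜_{k:ℓ+1}) (‖𝒜_ℓ‖ ‖ϱ_ℓ − 𝒟(ϱ_ℓ)‖₂ + ‖𝒜_ℓ(ϱ_ℓ) − 𝒟(𝒜_ℓ(ϱ_ℓ))‖₂)
+ Σ_{ℓ=0}^{k−1} ν(𝒜_{k:ℓ+1}) (‖𝒟(𝒜_ℓ(ϱ_ℓ)) − ϖ_{ℓ+1}‖₂ + ‖𝒜_ℓ‖ ‖𝒟(ϱ_ℓ) − ϖ_ℓ‖₂)`,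
where `𝔖_{b:a} = ∏_{j=a}^{b} max_{n≠m} |G⁽ʲ⁾_{nm}|`. -/
theorem refined_multitime_equilibration_bound {d : ℕ} {ι : Type*}
    [Fintype ι] [DecidableEq ι] [Nontrivial ι]
    (P : ι → Matrix (Fin d) (Fin d) ℂ)
    (hHerm : ∀ n, (P n)ᴴ = P n)
    (hOrth : ∀ n m, n ≠ m → P n * P m = 0)
    (hIdem : ∀ n, P n * P n = P n)
    (hSum : ∑ n, P n = 1)
    (ϱ : Matrix (Fin d) (Fin d) ℂ) (hϱ : ϱᴴ = ϱ)
    (k : ℕ)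
    (A : ℕ → Module.End ℂ (Matrix (Fin d) (Fin d) ℂ))
    (hA : ∀ j, j ≤ k → ∀ X : Matrix (Fin d) (Fin d) ℂ, Xᴴ = X → (A j X)ᴴ = A j X)
    (G : ℕ → ι → ι → ℂ)
    (hGdiag : ∀ j, j ≤ k → ∀ n, G j n n = 1)
    (hGherm : ∀ j, j ≤ k → ∀ n m, G j m n = (starRingEnd ℂ) (G j n m)) :
    ‖(chainApply (fun j X => A j (pdeph P (G j) X)) (k + 1) ϱ).trace -
        (chainApply (fun j X => A j (deph P X)) (k + 1) ϱ).trace‖ ≤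
      (∏ j ∈ Finset.Icc 0 k, maxOffDiag (G j)) * nuFrob (chainEnd A 0 (k + 1)) *
          frob (ϱ - deph P ϱ) +
        (∑ ℓ ∈ Finset.range k,
          (∏ j ∈ Finset.Icc (ℓ + 1) k, maxOffDiag (G j)) *
            nuFrob (chainEnd A (ℓ + 1) (k - ℓ)) *
            (opFrob (A ℓ) *
                frob
                  (pdeph P (G ℓ) (chainApply (fun j X => A j (pdeph P (G j) X)) ℓ ϱ) -
                    deph P (pdeph P (G ℓ)
                      (chainApply (fun j X => A j (pdeph P (G j) X)) ℓ ϱ))) +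
              frob
                (A ℓ (pdeph P (G ℓ) (chainApply (fun j X => A j (pdeph P (G j) X)) ℓ ϱ)) -
                  deph P (A ℓ (pdeph P (G ℓ)
                    (chainApply (fun j X => A j (pdeph P (G j) X)) ℓ ϱ)))))) +
        ∑ ℓ ∈ Finset.range k,
          nuFrob (chainEnd A (ℓ + 1) (k - ℓ)) *
            (frob
                (deph P (A ℓ (pdeph P (G ℓ)
                      (chainApply (fun j X => A j (pdeph P (G j) X)) ℓ ϱ))) -
                  deph P (chainApply (fun j X => A j (deph P X)) (ℓ + 1) ϱ)) +
              opFrob (A ℓ) *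
                frob
                  (deph P (pdeph P (G ℓ)
                      (chainApply (fun j X => A j (pdeph P (G j) X)) ℓ ϱ)) -
                    deph P (chainApply (fun j X => A j (deph P X)) ℓ ϱ))) := by
  have hprod : ∀ s : Finset ℕ, 0 ≤ ∏ j ∈ s, maxOffDiag (G j) := fun s =>
    Finset.prod_nonneg fun j _ => maxOffDiag_nonneg (G j)
  have key := norm_trace_pdeph_sub_le hHerm hOrth hIdem hSum (G k) (hGdiag k le_rfl) (A k)
    (chainApply (fun j X => A j (pdeph P (G j) X)) k ϱ)
    (deph P (chainApply (fun j X => A j (deph P X)) k ϱ))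
  refine le_trans key ?_
  cases k with
  | zero =>
    simp [chainApply, chainEnd_one, frob]
  | succ k =>
    rw [Finset.sum_range_succ, Finset.sum_range_succ, Nat.add_sub_cancel_left, chainEnd_one,
      Finset.Icc_self, Finset.prod_singleton, add_assoc]
    -- Only the last summand of each sum is needed; all the other terms are nonnegative.
    refine le_add_of_nonneg_of_le (mul_nonneg (mul_nonneg (hprod _) (nuFrob_nonneg _))
      (frob_nonneg _)) (add_le_add (le_add_of_nonneg_of_le ?_ ?_) (le_add_of_nonneg_of_le ?_ ?_))
    · exact Finset.sum_nonneg fun ℓ _ => mul_nonneg (mul_nonneg (hprod _) (nuFrob_nonneg _))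
        (add_nonneg (mul_nonneg (opFrob_nonneg _) (frob_nonneg _)) (frob_nonneg _))
    · exact mul_le_mul_of_nonneg_left
        (le_add_of_nonneg_left (mul_nonneg (opFrob_nonneg _) (frob_nonneg _)))
        (mul_nonneg (maxOffDiag_nonneg _) (nuFrob_nonneg _))
    · exact Finset.sum_nonneg fun ℓ _ => mul_nonneg (nuFrob_nonneg _)
        (add_nonneg (frob_nonneg _) (mul_nonneg (opFrob_nonneg _) (frob_nonneg _)))
    · exact mul_le_mul_of_nonneg_left
        (le_add_of_nonneg_right (mul_nonneg (opFrob_nonneg _) (frob_nonneg _)))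
        (nuFrob_nonneg _)
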